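/- Let p ≥ 3 be a prime and let b, q, r be natural numbers with 2 ≤ b < p, p = q·b + r, and 0 < r < b. Let L := {(a₁, a₂) ∈ ℤ² | a₁ + b·a₂ ≡ 0 (mod p)}. Then L is generated in degree ≤ q + b + r − 1; moreover, if q ≥ r·(r − 1), then L is not generated in degree ≤ q + b + r − 2, so the generation degree of L is exactly q + b + r − 1. (This is the lattice form of: for G = ℤ/pℤ and V with two distinct nontrivial characters A₁, A₂ with bA₁ ≡ A₂ (mod p), β_field(G,V) ≤ q + b + r − 1, with equality if q ≥ r(r−1).) -/

import Mathlib

/-- The lattice `{(a₁, a₂) ∈ ℤ² | a₁ + b·a₂ ≡ 0 (mod p)}`. -/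
def latMod (p b : ℕ) : AddSubgroup (Fin 2 → ℤ) where
  carrier := {a | (p : ℤ) ∣ a 0 + (b : ℤ) * a 1}
  zero_mem' := by simp
  add_mem' := by
    intro x y hx hy
    simp only [Set.mem_setOf_eq, Pi.add_apply] at *
    have h : x 0 + y 0 + (b : ℤ) * (x 1 + y 1) = (x 0 + b * x 1) + (y 0 + b * y 1) := by ring
    rw [h]
    exact dvd_add hx hy
  neg_mem' := by
    intro x hx
    simp only [Set.mem_setOf_eq, Pi.neg_apply] at *
    have h : -x 0 + (b : ℤ) * (-x 1) = -(x 0 + b * x 1) := by ring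
    rw [h]
    exact dvd_neg.mpr hx

/-- `latMod p b` is generated in degree `≤ d`. -/
def genLE10 (p b d : ℕ) : Prop :=
  AddSubgroup.closure
      {a | a ∈ latMod p b ∧ (∀ i, 0 ≤ a i) ∧ a 0 + a 1 ≤ (d : ℤ)} = latMod p b

theorem mem_latMod {p b : ℕ} {a : Fin 2 → ℤ} :
    a ∈ latMod p b ↔ (p : ℤ) ∣ a 0 + (b : ℤ) * a 1 := Iff.rfl

/-- A nonnegative lattice point `(k r + n b, k q - n)` with `n < 0` has degree at least
`q + b + r - 1`, provided that `q ≥ r (r - 1)`. -/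
theorem degree_lower_bound {b q r k t : ℤ} (hb2 : 2 ≤ b) (hq : 1 ≤ q) (hr0 : 0 < r)
    (hrb : r < b) (hco : IsCoprime b r) (hqr : r * (r - 1) ≤ q) (ht : 1 ≤ t)
    (hx : 0 ≤ k * r - t * b) :
    q + b + r - 1 ≤ (k * r - t * b) + (k * q + t) := by
  by_contra! hdeg
  have hk : 2 ≤ k := by
    by_contra! hk
    nlinarith
  have hbk : b ≤ k := by
    rcases eq_or_lt_of_le (show 1 ≤ r by lia) with rfl | hr
    · nlinarith
    · have h1 : (k - 1) * (r * (r - 1)) ≤ (k - 1) * q :=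
        mul_le_mul_of_nonneg_left hqr (by lia)
      have h2 : r * (k * r - t * b) + t * ((r - 1) * b + 1) ≤ b + r * r - 2 := by
        nlinarith
      have h3 : (r - 1) * b + 1 ≤ t * ((r - 1) * b + 1) :=
        le_mul_of_one_le_left (by nlinarith) ht
      have h4 : (r - 2) * (r + 1) ≤ (r - 2) * b :=
        mul_le_mul_of_nonneg_left (by lia) (by lia)
      have h5 : k * r - t * b = 0 := by
        by_contra h
        have h6 : 1 ≤ k * r - t * b := lt_of_le_of_ne hx (Ne.symm h)
        nlinarith
      have h7 : b ∣ k := hco.dvd_of_dvd_mul_right ⟨t, by linarith⟩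
      exact Int.le_of_dvd (by lia) h7
  have hrq : r ≤ q := by
    rcases eq_or_lt_of_le (show 1 ≤ r by lia) with rfl | hr
    · exact hq
    · nlinarith
  have h1 : (b - 1) * r ≤ (b - 1) * q := mul_le_mul_of_nonneg_left hrq (by lia)
  have h2 : (b - 1) * q ≤ (k - 1) * q := mul_le_mul_of_nonneg_right (by lia) (by lia)
  nlinarith [mul_nonneg (show 0 ≤ r - 1 by lia) (show 0 ≤ b - 2 by lia)]

/-- A nonnegative lattice point of degree less than `q + b + r - 1` is proportional to
`(r, q)`, provided that `q ≥ r (r - 1)`. -/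
theorem proportional_of_degree_lt {b q r x y k : ℤ} (hb2 : 2 ≤ b) (hq : 1 ≤ q) (hr0 : 0 < r)
    (hrb : r < b) (hco : IsCoprime b r) (hqr : r * (r - 1) ≤ q) (hx : 0 ≤ x) (hy : 0 ≤ y)
    (hk : x + b * y = (q * b + r) * k) (hdeg : x + y < q + b + r - 1) :
    x * q = y * r := by
  have hxk : x = k * r + (k * q - y) * b := by linarith
  rcases lt_trichotomy (k * q - y) 0 with hn | hn | hn
  · have := degree_lower_bound (k := k) (t := y - k * q) hb2 hq hr0 hrb hco hqr (by lia)
      (by linarith)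
    linarith
  · rw [hn] at hxk
    rw [hxk, show y = k * q by linarith]
    ring
  · have hk1 : 1 ≤ k := by
      by_contra! h
      nlinarith
    have h1 : b - 1 ≤ (k * q - y) * (b - 1) := le_mul_of_one_le_left (by lia) (by lia)
    have h2 : r + q ≤ k * (r + q) := le_mul_of_one_le_left (by lia) hk1
    linarith

/-- Let `p ≥ 3` be prime, `2 ≤ b < p`, `p = q·b + r` with `0 < r < b`, and
`L = {(a₁,a₂) | a₁ + b·a₂ ≡ 0 (mod p)}`. Then `L` is generated in degree `≤ q + b + r − 1`;
moreover, if `q ≥ r(r−1)` then `L` is not generated in degree `≤ q + b + r − 2`, so the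
generation degree is exactly `q + b + r − 1`. -/
theorem stmt_10 (p b q r : ℕ) (hp : p.Prime) (hp3 : 3 ≤ p) (hb2 : 2 ≤ b) (hbp : b < p)
    (hpqr : p = q * b + r) (hr0 : 0 < r) (hrb : r < b) :
    genLE10 p b (q + b + r - 1) ∧
      (r * (r - 1) ≤ q → ¬ genLE10 p b (q + b + r - 2)) := by
  have hp1 : (p : ℤ) = q * b + r := by exact_mod_cast hpqr
  have hq : 1 ≤ q := by
    by_contra! h
    obtain rfl : q = 0 := by lia
    lia
  have hv : (![(r : ℤ) + b, (q : ℤ) - 1] : Fin 2 → ℤ) ∈ latMod p b := by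
    rw [mem_latMod]
    exact ⟨1, by simp; linarith⟩
  refine ⟨?_, fun hqr hgen => ?_⟩
  · refine le_antisymm ((AddSubgroup.closure_le _).2 fun a ha => ha.1) fun a ha => ?_
    obtain ⟨k, hk⟩ := mem_latMod.1 ha
    have hu : (![(r : ℤ), (q : ℤ)] : Fin 2 → ℤ) ∈ latMod p b := by
      rw [mem_latMod]
      exact ⟨1, by simp; linarith⟩
    have hdecomp : a = (k - (k * q - a 1)) • ![(r : ℤ), (q : ℤ)]
        + (k * q - a 1) • ![(r : ℤ) + b, (q : ℤ) - 1] := by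
      rw [hp1] at hk
      ext i
      fin_cases i
      · simp
        linarith
      · simp
        ring
    rw [hdecomp]
    refine add_mem (zsmul_mem (AddSubgroup.subset_closure ?_) _)
      (zsmul_mem (AddSubgroup.subset_closure ?_) _)
    · refine ⟨hu, by simp [Fin.forall_fin_two], ?_⟩
      simp
      lia
    · refine ⟨hv, ?_, ?_⟩
      · simp [Fin.forall_fin_two]
        lia
      · simp
        lia
  · have hco : IsCoprime (b : ℤ) (r : ℤ) := by
      rw [Nat.isCoprime_iff_coprime]
      have hdvd : Nat.gcd b r ∣ p := by
        rw [hpqr]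
        exact dvd_add ((Nat.gcd_dvd_left b r).mul_left q) (Nat.gcd_dvd_right b r)
      have hle : Nat.gcd b r ≤ r := Nat.gcd_le_right b hr0
      rcases (Nat.dvd_prime hp).1 hdvd with h | h
      · exact h
      · lia
    have hqr' : (r : ℤ) * (r - 1) ≤ q := by
      have h : ((r * (r - 1) : ℕ) : ℤ) ≤ q := by exact_mod_cast hqr
      rwa [Nat.cast_mul, Nat.cast_sub hr0, Nat.cast_one] at h
    have hall : ∀ a ∈ latMod p b, a 0 * (q : ℤ) = a 1 * r := by
      intro a ha
      rw [← hgen] at ha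
      induction ha using AddSubgroup.closure_induction with
      | mem x hx =>
        obtain ⟨hxL, hx0, hxd⟩ := hx
        obtain ⟨k, hk⟩ := mem_latMod.1 hxL
        rw [hp1] at hk
        exact proportional_of_degree_lt (by lia) (by lia) (by lia) (by lia) hco hqr'
          (hx0 0) (hx0 1) hk (by lia)
      | zero => simp
      | add x y _ _ hx hy =>
        simp only [Pi.add_apply, add_mul, hx, hy]
      | neg x _ hx =>
        simp only [Pi.neg_apply, neg_mul, hx]
    have h := hall _ hv
    simp at h
    have : (0 : ℤ) < p := by lia
    linarith
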